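/- arXiv:1811.04194 — 2 statements merged into one kernel-verified Lean document; each statement's English description precedes it below -/
import Mathlib

section
/- Let E be a real inner product space, f : E → ℝ differentiable with L-Lipschitz gradient (L > 0) and bounded below by f*, and ε > 0. Let x_0, x_1, …, x_T (T ≥ 1) be generated by x_{k+1} = x_k − v_k/(2L) where each v_k ∈ E satisfies ‖v_k − ∇f(x_k)‖² ≤ ε². Then (1/T)·Σ_{k=0}^{T−1} ‖∇f(x_k)‖² ≤ 16L·(f(x_0) − f*)/T + 6ε². -/
/-- A function with `L`-Lipschitz gradient lies below its quadratic upper model. -/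
theorem descent_of_lipschitz_gradient
    {E : Type*} [NormedAddCommGroup E] [InnerProductSpace ℝ E]
    {f : E → ℝ} {f' : E → E} {L : ℝ}
    (hdiff : ∀ x, HasFDerivAt f (innerSL ℝ (f' x)) x)
    (hlip : ∀ x y, ‖f' x - f' y‖ ≤ L * ‖x - y‖) (x d : E) :
    f (x + d) ≤ f x + inner ℝ (f' x) d + L / 2 * ‖d‖ ^ 2 := by
  have hderiv (t : ℝ) : HasDerivAt
      (fun s : ℝ => f (x + s • d) - s * inner ℝ (f' x) d - s ^ 2 * (L / 2 * ‖d‖ ^ 2))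
      (inner ℝ (f' (x + t • d)) d - inner ℝ (f' x) d - 2 * t * (L / 2 * ‖d‖ ^ 2)) t := by
    have hline : HasDerivAt (fun s : ℝ => x + s • d) d t := by
      simpa using ((hasDerivAt_id t).smul_const d).const_add x
    have hf : HasDerivAt (fun s : ℝ => f (x + s • d)) (inner ℝ (f' (x + t • d)) d) t := by
      exact (hdiff (x + t • d)).comp_hasDerivAt t hline
    have hlin : HasDerivAt (fun s : ℝ => s * inner ℝ (f' x) d) (inner ℝ (f' x) d) t := by
      simpa using (hasDerivAt_id t).mul_const (inner ℝ (f' x) d)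
    have hquad : HasDerivAt (fun s : ℝ => s ^ 2 * (L / 2 * ‖d‖ ^ 2))
        (2 * t * (L / 2 * ‖d‖ ^ 2)) t := by
      simpa using (hasDerivAt_pow 2 t).mul_const (L / 2 * ‖d‖ ^ 2)
    exact (hf.sub hlin).sub hquad
  obtain ⟨c, hc, hslope⟩ := exists_hasDerivAt_eq_slope _ _ zero_lt_one
    (fun t _ => (hderiv t).continuousAt.continuousWithinAt) (fun t _ => hderiv t)
  have hgrad : inner ℝ (f' (x + c • d)) d - inner ℝ (f' x) d ≤ c * (L * ‖d‖ ^ 2) := by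
    calc inner ℝ (f' (x + c • d)) d - inner ℝ (f' x) d
        = inner ℝ (f' (x + c • d) - f' x) d := (inner_sub_left _ _ _).symm
      _ ≤ ‖f' (x + c • d) - f' x‖ * ‖d‖ := real_inner_le_norm _ _
      _ ≤ L * ‖x + c • d - x‖ * ‖d‖ := by gcongr; exact hlip _ _
      _ = c * (L * ‖d‖ ^ 2) := by
        rw [add_sub_cancel_left, norm_smul, Real.norm_of_nonneg hc.1.le]
        ring
  simp only [one_smul, zero_smul, add_zero, sub_zero, div_one] at hslope
  linarith

/-- One inexact gradient step of length `1 / (2L)` decreases `f` by a multiple of the squared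
gradient norm, up to the squared error of the gradient estimate `v`. -/
theorem sq_norm_gradient_le_of_inexact_step
    {E : Type*} [NormedAddCommGroup E] [InnerProductSpace ℝ E]
    {f : E → ℝ} {f' : E → E} {L : ℝ} (hL : 0 < L)
    (hdiff : ∀ x, HasFDerivAt f (innerSL ℝ (f' x)) x)
    (hlip : ∀ x y, ‖f' x - f' y‖ ≤ L * ‖x - y‖) (x v : E) :
    ‖f' x‖ ^ 2 ≤ 4 * L * (f x - f (x - (1 / (2 * L)) • v)) + ‖v - f' x‖ ^ 2 := by
  have hdesc := descent_of_lipschitz_gradient hdiff hlip x (-((1 / (2 * L)) • v))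
  rw [← sub_eq_add_neg, inner_neg_right, real_inner_smul_right, norm_neg, norm_smul, mul_pow,
    Real.norm_of_nonneg (by positivity)] at hdesc
  have hscaled : 4 * L * (f (x - (1 / (2 * L)) • v) - f x)
      ≤ -2 * inner ℝ (f' x) v + ‖v‖ ^ 2 / 2 := by
    calc 4 * L * (f (x - (1 / (2 * L)) • v) - f x)
        ≤ 4 * L * (-(1 / (2 * L) * inner ℝ (f' x) v)
            + L / 2 * ((1 / (2 * L)) ^ 2 * ‖v‖ ^ 2)) := by
          gcongr
          linarith
      _ = -2 * inner ℝ (f' x) v + ‖v‖ ^ 2 / 2 := by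
          field_simp
          ring
  have herr := norm_sub_sq_real v (f' x)
  rw [real_inner_comm] at herr
  linarith [sq_nonneg ‖v‖]

/-- Let `E` be a real inner product space, `f : E → ℝ`
differentiable with `L`-Lipschitz gradient `f'` (`L > 0`) and bounded below by
`f*`, and `ε > 0`. Let `x_0, …, x_T` (`T ≥ 1`) be generated by
`x_{k+1} = x_k − v_k/(2L)` where each `v_k` satisfies
`‖v_k − ∇f(x_k)‖² ≤ ε²`. Then
`(1/T) Σ_{k<T} ‖∇f(x_k)‖² ≤ 16L (f(x_0) − f*)/T + 6ε²`. -/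
theorem stmt_10
    {E : Type*} [NormedAddCommGroup E] [InnerProductSpace ℝ E]
    (f : E → ℝ) (f' : E → E) (L fstar ε : ℝ) (hL : 0 < L) (hε : 0 < ε)
    (hdiff : ∀ x, HasFDerivAt f (innerSL ℝ (f' x)) x)
    (hlip : ∀ x y, ‖f' x - f' y‖ ≤ L * ‖x - y‖)
    (hbdd : ∀ x, fstar ≤ f x)
    (T : ℕ) (hT : 1 ≤ T) (x v : ℕ → E)
    (hupd : ∀ k < T, x (k + 1) = x k - (1 / (2 * L)) • v k)
    (herr : ∀ k < T, ‖v k - f' (x k)‖ ^ 2 ≤ ε ^ 2) :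
    (1 / (T : ℝ)) * ∑ k ∈ Finset.range T, ‖f' (x k)‖ ^ 2
      ≤ 16 * L * (f (x 0) - fstar) / T + 6 * ε ^ 2 := by
  have hT0 : (0 : ℝ) < T := by exact_mod_cast hT
  have hstep : ∀ k ∈ Finset.range T,
      ‖f' (x k)‖ ^ 2 ≤ 4 * L * (f (x k) - f (x (k + 1))) + ε ^ 2 := by
    intro k hk
    have hkT := Finset.mem_range.mp hk
    have hdecr := sq_norm_gradient_le_of_inexact_step hL hdiff hlip (x k) (v k)
    rw [← hupd k hkT] at hdecr
    linarith [herr k hkT]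
  have hsum : ∑ k ∈ Finset.range T, ‖f' (x k)‖ ^ 2
      ≤ 4 * L * (f (x 0) - f (x T)) + T * ε ^ 2 := by
    refine (Finset.sum_le_sum hstep).trans_eq ?_
    rw [Finset.sum_add_distrib, ← Finset.mul_sum, Finset.sum_range_sub' (fun k => f (x k))]
    simp
  have hlast : L * (f (x 0) - f (x T)) ≤ L * (f (x 0) - fstar) := by
    gcongr
    exact hbdd _
  have hgap : 0 ≤ L * (f (x 0) - fstar) := mul_nonneg hL.le (sub_nonneg.mpr (hbdd _))
  have herr_nonneg : 0 ≤ T * ε ^ 2 := by positivity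
  rw [one_div_mul_eq_div, div_add' _ _ _ hT0.ne']
  gcongr
  linarith
end

section
/- Let E be a real inner product space, f : E → ℝ differentiable with L-Lipschitz gradient (L > 0), and δ ≥ 0. Let x_0, x_1, …, x_q be generated by x_{k+1} = x_k − v_k/(2L) where each v_k ∈ E satisfies ‖v_k − ∇f(x_k)‖² ≤ δ. Then (L/2)·Σ_{k=0}^{q−1} ‖x_{k+1} − x_k‖² ≤ f(x_0) − f(x_q) + q·δ/L. -/
/-- The descent lemma: a function with `L`-Lipschitz gradient is bounded above by its quadratic
model. -/
theorem le_add_inner_add_of_lipschitz_gradient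
    {E : Type*} [NormedAddCommGroup E] [InnerProductSpace ℝ E]
    {f : E → ℝ} {f' : E → E} {L : ℝ}
    (hdiff : ∀ x, HasFDerivAt f (innerSL ℝ (f' x)) x)
    (hlip : ∀ x y, ‖f' x - f' y‖ ≤ L * ‖x - y‖) (x s : E) :
    f (x + s) ≤ f x + inner ℝ (f' x) s + L / 2 * ‖s‖ ^ 2 := by
  have hderiv (t : ℝ) : HasDerivAt
      (fun t : ℝ => f (x + t • s) - t * inner ℝ (f' x) s - L / 2 * ‖s‖ ^ 2 * t ^ 2)
      (inner ℝ (f' (x + t • s)) s - inner ℝ (f' x) s - L * ‖s‖ ^ 2 * t) t := by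
    have hline : HasDerivAt (fun t : ℝ => x + t • s) s t := by
      simpa using ((hasDerivAt_id t).smul_const s).const_add x
    have hcomp : HasDerivAt (fun t : ℝ => f (x + t • s)) (inner ℝ (f' (x + t • s)) s) t := by
      simpa [Function.comp_def] using (hdiff (x + t • s)).comp_hasDerivAt t hline
    have hlin : HasDerivAt (fun t : ℝ => t * inner ℝ (f' x) s) (inner ℝ (f' x) s) t := by
      simpa using (hasDerivAt_id t).mul_const (inner ℝ (f' x) s)
    have hquad : HasDerivAt (fun t : ℝ => L / 2 * ‖s‖ ^ 2 * t ^ 2) (L * ‖s‖ ^ 2 * t) t := by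
      refine ((hasDerivAt_pow 2 t).const_mul (L / 2 * ‖s‖ ^ 2)).congr_deriv ?_
      norm_num
      ring
    exact (hcomp.sub hlin).sub hquad
  have hanti := antitoneOn_of_deriv_nonpos (convex_Icc (0 : ℝ) 1)
    (fun t _ => (hderiv t).continuousAt.continuousWithinAt)
    (fun t _ => (hderiv t).differentiableAt.differentiableWithinAt)
    (fun t ht => by
      rw [interior_Icc] at ht
      rw [(hderiv t).deriv, ← inner_sub_left]
      have hgrad : ‖f' (x + t • s) - f' x‖ ≤ L * (t * ‖s‖) := by
        simpa [norm_smul, abs_of_pos ht.1] using hlip (x + t • s) x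
      have hinner := real_inner_le_norm (f' (x + t • s) - f' x) s
      nlinarith [mul_le_mul_of_nonneg_right hgrad (norm_nonneg s)])
  have h := hanti (Set.left_mem_Icc.2 zero_le_one) (Set.right_mem_Icc.2 zero_le_one) zero_le_one
  simp only [one_smul, zero_smul, add_zero] at h
  linarith

/-- One inexact gradient step with step size `1 / (2 * L)` decreases the function by a multiple of
the squared step length, up to the squared error of the gradient estimate. -/
theorem sq_norm_inexact_gradient_step_le
    {E : Type*} [NormedAddCommGroup E] [InnerProductSpace ℝ E]
    {f : E → ℝ} {f' : E → E} {L : ℝ} (hL : 0 < L)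
    (hdiff : ∀ x, HasFDerivAt f (innerSL ℝ (f' x)) x)
    (hlip : ∀ x y, ‖f' x - f' y‖ ≤ L * ‖x - y‖)
    {x y v : E} (hy : y = x - (1 / (2 * L)) • v) :
    L / 2 * ‖y - x‖ ^ 2 ≤ f x - f y + ‖v - f' x‖ ^ 2 / (4 * L) := by
  have hdescent := le_add_inner_add_of_lipschitz_gradient hdiff hlip x (y - x)
  rw [add_sub_cancel] at hdescent
  have hv : v = -(2 * L) • (y - x) := by
    rw [hy, sub_sub_cancel_left, neg_smul_neg, smul_smul, mul_one_div_cancel (by positivity),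
      one_smul]
  have hsplit : inner ℝ (f' x) (y - x)
      = -(2 * L) * ‖y - x‖ ^ 2 - inner ℝ (v - f' x) (y - x) := by
    rw [inner_sub_left, hv, real_inner_smul_left, real_inner_self_eq_norm_sq]
    ring
  have hcs := (abs_le.1 (abs_real_inner_le_norm (v - f' x) (y - x))).1
  have hyoung : ‖v - f' x‖ * ‖y - x‖ ≤ ‖v - f' x‖ ^ 2 / (4 * L) + L * ‖y - x‖ ^ 2 := by
    have hsq : 0 ≤ (‖v - f' x‖ - 2 * L * ‖y - x‖) ^ 2 / (4 * L) := by positivity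
    have hexp : (‖v - f' x‖ - 2 * L * ‖y - x‖) ^ 2 / (4 * L)
        = ‖v - f' x‖ ^ 2 / (4 * L) + L * ‖y - x‖ ^ 2 - ‖v - f' x‖ * ‖y - x‖ := by
      field_simp
      ring
    linarith
  linarith


/-- Let `E` be a real inner product space, `f : E → ℝ`
differentiable with `L`-Lipschitz gradient `f'` (`L > 0`), and `δ ≥ 0`.
Let `x_0, …, x_q` be generated by `x_{k+1} = x_k − v_k/(2L)` where each `v_k`
satisfies `‖v_k − ∇f(x_k)‖² ≤ δ`. Then
`(L/2) Σ_{k<q} ‖x_{k+1} − x_k‖² ≤ f(x_0) − f(x_q) + qδ/L`. -/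
theorem stmt_12
    {E : Type*} [NormedAddCommGroup E] [InnerProductSpace ℝ E]
    (f : E → ℝ) (f' : E → E) (L δ : ℝ) (hL : 0 < L) (hδ : 0 ≤ δ)
    (hdiff : ∀ x, HasFDerivAt f (innerSL ℝ (f' x)) x)
    (hlip : ∀ x y, ‖f' x - f' y‖ ≤ L * ‖x - y‖)
    (q : ℕ) (x v : ℕ → E)
    (hupd : ∀ k < q, x (k + 1) = x k - (1 / (2 * L)) • v k)
    (herr : ∀ k < q, ‖v k - f' (x k)‖ ^ 2 ≤ δ) :
    (L / 2) * ∑ k ∈ Finset.range q, ‖x (k + 1) - x k‖ ^ 2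
      ≤ f (x 0) - f (x q) + q * δ / L := by
  have hstep (k : ℕ) (hk : k ∈ Finset.range q) :
      L / 2 * ‖x (k + 1) - x k‖ ^ 2 ≤ (f (x k) - f (x (k + 1))) + δ / L := by
    have hkq := Finset.mem_range.1 hk
    have h := sq_norm_inexact_gradient_step_le hL hdiff hlip (hupd k hkq)
    have herror : ‖v k - f' (x k)‖ ^ 2 / (4 * L) ≤ δ / L :=
      div_le_div₀ hδ (herr k hkq) hL (by linarith)
    linarith
  rw [Finset.mul_sum]
  refine (Finset.sum_le_sum hstep).trans_eq ?_
  rw [Finset.sum_add_distrib, Finset.sum_range_sub' (fun k => f (x k)), Finset.sum_const,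
    Finset.card_range, nsmul_eq_mul, mul_div_assoc]
end
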